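/- arXiv:1612.05620 — 2 statements merged into one kernel-verified Lean document; each statement's English description precedes it below -/
import Mathlib

section
/- For every v ∈ C₀[a,b] and every h ∈ C₀[a,b], the Gâteaux derivative of K at v in direction h exists and equals T_v(h): lim_{t → 0, t ≠ 0} (K(v + t·h) − K(v))/t = T_v(h). Moreover, for every p ∈ [1,∞], the linear functional T_v is bounded with respect to ‖·‖_p: with γ_v := ‖θ·(v((1/2)v² − λ) − F)‖_∞ and p' the conjugate exponent of p, one has |T_v(h)| ≤ γ_v (b−a)^{1/p'} ‖h‖_p for all h ∈ C₀[a,b]. -/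
open Set MeasureTheory intervalIntegral Filter Topology

/-- The supremum norm of `h` on `[a,b]`. -/
noncomputable def supN (a b : ℝ) (h : ℝ → ℝ) : ℝ := sSup ((fun x => |h x|) '' Set.Icc a b)

/-- The `p`-norm (`p ∈ [1,∞]`) of `h` on `[a,b]`. -/
noncomputable def pN (a b : ℝ) (p : ENNReal) (h : ℝ → ℝ) : ℝ :=
  if p = ⊤ then supN a b h else (∫ x in a..b, |h x| ^ p.toReal) ^ (1 / p.toReal)

/-- `C₀[a,b]`: continuous functions on `[a,b]` vanishing at the endpoints. -/
def C0 (a b : ℝ) (h : ℝ → ℝ) : Prop := ContinuousOn h (Set.Icc a b) ∧ h a = 0 ∧ h b = 0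

/-- The functional `K(v) = ∫_a^b θ(x) (H(v(x)) - F(x) v(x)) dx`,
with `H(y) = (1/2)((1/2)y² - λ)²`. -/
noncomputable def Kf (a b lam : ℝ) (θ F : ℝ → ℝ) (v : ℝ → ℝ) : ℝ :=
  ∫ x in a..b, θ x * ((1/2) * ((1/2) * v x ^ 2 - lam) ^ 2 - F x * v x)

/-- The linear functional `T_v(h) = ∫_a^b θ(x)(v(x)((1/2)v(x)² - λ) - F(x)) h(x) dx`. -/
noncomputable def Tf (a b lam : ℝ) (θ F : ℝ → ℝ) (v h : ℝ → ℝ) : ℝ :=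
  ∫ x in a..b, θ x * (v x * ((1/2) * v x ^ 2 - lam) - F x) * h x

/-- `1/p'` where `p'` is the conjugate exponent of `p`:
`p' = p/(p-1)` for `p ∈ (1,∞)`, `p' = ∞` for `p = 1` (so `1/p' = 0`),
`p' = 1` for `p = ∞` (so `1/p' = 1`). -/
noncomputable def invConj (p : ENNReal) : ℝ :=
  if p = ⊤ then 1 else 1 - 1 / p.toReal

theorem aux_le_supN {a b : ℝ} {g : ℝ → ℝ} (hg : ContinuousOn g (Set.Icc a b)) {x : ℝ}
    (hx : x ∈ Set.Icc a b) : |g x| ≤ supN a b g :=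
  le_csSup (isCompact_Icc.image_of_continuousOn hg.abs).bddAbove ⟨x, hx, rfl⟩

theorem aux_holder {a b : ℝ} (hab : a < b) {h : ℝ → ℝ} (hh : ContinuousOn h (Set.Icc a b))
    (p : ENNReal) (hp : 1 ≤ p) :
    ∫ x in a..b, |h x| ≤ (b - a) ^ invConj p * pN a b p h := by
  have hi : IntervalIntegrable (fun x => |h x|) volume a b :=
    hh.abs.intervalIntegrable_of_Icc hab.le
  unfold invConj pN
  by_cases htop : p = ⊤
  · simp only [htop, if_true, Real.rpow_one]
    have := integral_mono_on hab.le hi (intervalIntegrable_const (c := supN a b h))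
      (fun x hx => aux_le_supN hh hx)
    simpa using this
  simp only [htop, if_false]
  have hp1 : 1 ≤ p.toReal := by
    have := ENNReal.toReal_mono htop hp
    simpa using this
  rcases hp1.eq_or_lt with h1 | h1
  · rw [← h1]; simp
  have hpq := Real.HolderConjugate.conjExponent h1
  have hq0 := hpq.symm.pos
  have hm : AEStronglyMeasurable (fun x => |h x|) (volume.restrict (Set.Ioc a b)) := hi.1.1
  have hL : MemLp (fun x => |h x|) (ENNReal.ofReal p.toReal) (volume.restrict (Set.Ioc a b)) := by
    refine MemLp.of_bound hm (supN a b h) ?_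
    filter_upwards [ae_restrict_mem measurableSet_Ioc] with x hx
    simpa using aux_le_supN hh (Set.Ioc_subset_Icc_self hx)
  have key := integral_mul_le_Lp_mul_Lq_of_nonneg hpq
    (μ := volume.restrict (Set.Ioc a b)) (f := fun x => |h x|) (g := fun _ => (1 : ℝ))
    (Eventually.of_forall fun x => abs_nonneg _) (Eventually.of_forall fun x => zero_le_one)
    hL (memLp_const 1)
  rw [integral_of_le hab.le, integral_of_le hab.le]
  have e : 1 - 1 / p.toReal = 1 / p.toReal.conjExponent := by
    have := hpq.inv_add_inv_eq_one
    simp only [one_div]; linarith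
  rw [e, mul_comm]
  simpa [hab.le] using key

theorem stmt2 (a b lam : ℝ) (hab : a < b) (hlam : 0 < lam)
    (θ : ℝ → ℝ) (hθc : ContinuousOn θ (Set.Icc a b)) (hθ : ∀ x ∈ Set.Icc a b, 0 < θ x)
    (F : ℝ → ℝ) (hF : ContDiffOn ℝ 1 F (Set.Icc a b)) (hFa : F a = 0) (hFb : F b = 0)
    (hFne : ∀ x ∈ Set.Ioo a b, F x ≠ 0)
    (hFsmall : supN a b F < (2 * lam / 3) ^ ((3 : ℝ) / 2)) :
    ∀ v : ℝ → ℝ, C0 a b v → ∀ h : ℝ → ℝ, C0 a b h →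
      (Tendsto (fun t : ℝ => (Kf a b lam θ F (v + t • h) - Kf a b lam θ F v) / t)
        (nhdsWithin 0 {0}ᶜ) (nhds (Tf a b lam θ F v h))) ∧
      ∀ p : ENNReal, 1 ≤ p →
        |Tf a b lam θ F v h| ≤
          supN a b (fun x => θ x * (v x * ((1/2) * v x ^ 2 - lam) - F x)) *
            (b - a) ^ invConj p * pN a b p h := by
  rintro v ⟨hv, -, -⟩ h ⟨hh, -, -⟩
  have hFc := hF.continuousOn
  have hg : ContinuousOn (fun x => θ x * (v x * ((1/2) * v x ^ 2 - lam) - F x)) (Set.Icc a b) := by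
    fun_prop
  constructor
  · have i0 : IntervalIntegrable
        (fun x => θ x * ((1/2) * ((1/2) * v x ^ 2 - lam) ^ 2 - F x * v x)) volume a b :=
      ContinuousOn.intervalIntegrable_of_Icc hab.le (by fun_prop)
    have i1 : IntervalIntegrable
        (fun x => θ x * (v x * ((1/2) * v x ^ 2 - lam) - F x) * h x) volume a b :=
      ContinuousOn.intervalIntegrable_of_Icc hab.le (by fun_prop)
    have i2 : IntervalIntegrable
        (fun x => θ x * ((3/2 * v x ^ 2 - lam) / 2 * h x ^ 2)) volume a b :=
      ContinuousOn.intervalIntegrable_of_Icc hab.le (by fun_prop)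
    have i3 : IntervalIntegrable (fun x => θ x * (v x / 2 * h x ^ 3)) volume a b :=
      ContinuousOn.intervalIntegrable_of_Icc hab.le (by fun_prop)
    have i4 : IntervalIntegrable (fun x => θ x * (h x ^ 4 / 8)) volume a b :=
      ContinuousOn.intervalIntegrable_of_Icc hab.le (by fun_prop)
    set A := ∫ x in a..b, θ x * ((3/2 * v x ^ 2 - lam) / 2 * h x ^ 2) with hA
    set B := ∫ x in a..b, θ x * (v x / 2 * h x ^ 3) with hB
    set C := ∫ x in a..b, θ x * (h x ^ 4 / 8) with hC
    have expand : ∀ t : ℝ, Kf a b lam θ F (v + t • h) =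
        Kf a b lam θ F v + t * Tf a b lam θ F v h + t ^ 2 * A + t ^ 3 * B + t ^ 4 * C := by
      intro t
      unfold Kf Tf
      rw [hA, hB, hC, ← intervalIntegral.integral_const_mul, ← intervalIntegral.integral_const_mul, ← intervalIntegral.integral_const_mul,
        ← intervalIntegral.integral_const_mul, ← intervalIntegral.integral_add i0 (i1.const_mul _),
        ← intervalIntegral.integral_add (i0.add (i1.const_mul _)) (i2.const_mul _),
        ← intervalIntegral.integral_add ((i0.add (i1.const_mul _)).add (i2.const_mul _)) (i3.const_mul _),
        ← intervalIntegral.integral_add (((i0.add (i1.const_mul _)).add (i2.const_mul _)).add (i3.const_mul _))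
          (i4.const_mul _)]
      congr 1
      funext x
      simp only [Pi.add_apply, Pi.smul_apply, smul_eq_mul]
      ring
    have lim : Tendsto (fun t : ℝ => Tf a b lam θ F v h + t * A + t ^ 2 * B + t ^ 3 * C)
        (nhdsWithin 0 {0}ᶜ) (nhds (Tf a b lam θ F v h)) := by
      have hc : Continuous (fun t : ℝ => Tf a b lam θ F v h + t * A + t ^ 2 * B + t ^ 3 * C) := by
        fun_prop
      have := (hc.tendsto 0).mono_left (nhdsWithin_le_nhds (s := {0}ᶜ))
      simpa using this
    refine lim.congr' ?_
    filter_upwards [self_mem_nhdsWithin] with t ht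
    have ht : t ≠ 0 := ht
    rw [expand t]
    field_simp
    ring
  · intro p hp
    set γ := supN a b (fun x => θ x * (v x * ((1/2) * v x ^ 2 - lam) - F x)) with hγ
    have hγ0 : 0 ≤ γ := (abs_nonneg _).trans (aux_le_supN hg (Set.left_mem_Icc.2 hab.le))
    have h1 : |Tf a b lam θ F v h| ≤ γ * ∫ x in a..b, |h x| := by
      unfold Tf
      refine (abs_integral_le_integral_abs hab.le).trans ?_
      rw [← intervalIntegral.integral_const_mul]
      refine integral_mono_on hab.le
        (ContinuousOn.intervalIntegrable_of_Icc hab.le (by fun_prop))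
        (ContinuousOn.intervalIntegrable_of_Icc hab.le (by fun_prop)) ?_
      intro x hx
      rw [abs_mul]
      exact mul_le_mul_of_nonneg_right (aux_le_supN hg hx) (abs_nonneg _)
    rw [mul_assoc]
    exact h1.trans (mul_le_mul_of_nonneg_left (aux_holder hab hh p hp) hγ0)
end

section
/- Let p satisfy 4 ≤ p < ∞ or p = ∞. Then for every v ∈ C₀[a,b], K is Fréchet differentiable at v with respect to the norm ‖·‖_p with derivative T_v; that is, for every ε > 0 there exists δ > 0 such that every h ∈ C₀[a,b] with 0 < ‖h‖_p < δ satisfies |K(v + h) − K(v) − T_v(h)| ≤ ε ‖h‖_p. -/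
open Set MeasureTheory intervalIntegral Filter Topology

lemma aux_pow (t q : ℝ) (ht : 0 ≤ t) (hq : 4 ≤ q) : t ^ 2 ≤ 1 + t ^ q ∧ t ^ 4 ≤ 1 + t ^ q := by
  have h0 : 0 ≤ t ^ q := Real.rpow_nonneg ht q
  rcases le_total t 1 with h1 | h1
  · have h2 : t ^ 2 ≤ 1 := pow_le_one₀ ht h1
    have h4 : t ^ 4 ≤ 1 := pow_le_one₀ ht h1
    constructor <;> linarith
  · have h4 : t ^ 4 ≤ t ^ q := by
      have := Real.rpow_le_rpow_of_exponent_le h1 hq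
      have e : t ^ (4 : ℝ) = t ^ 4 := by exact_mod_cast Real.rpow_natCast t 4
      rwa [e] at this
    have h2 : t ^ 2 ≤ t ^ 4 := pow_le_pow_right₀ h1 (by norm_num)
    constructor <;> linarith

lemma aux_dom (a b : ℝ) (hab : a < b) (p : ENNReal) (hp : 4 ≤ p) (h : ℝ → ℝ)
    (hc : ContinuousOn h (Set.Icc a b)) (hN : 0 < pN a b p h) :
    ∃ g : ℝ → ℝ, IntervalIntegrable g volume a b ∧ (∫ x in a..b, g x) ≤ b - a + 1 ∧
      ∀ x ∈ Set.Icc a b, h x ^ 2 ≤ pN a b p h ^ 2 * g x ∧ h x ^ 4 ≤ pN a b p h ^ 4 * g x := by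
  by_cases htop : p = ⊤
  · refine ⟨fun _ => 1, by simp, by simp, fun x hx => ?_⟩
    have hle : |h x| ≤ pN a b p h := by
      unfold pN supN
      rw [if_pos htop]
      exact le_csSup (isCompact_Icc.image_of_continuousOn hc.abs).bddAbove ⟨x, hx, rfl⟩
    have h2 := pow_le_pow_left₀ (abs_nonneg _) hle 2
    have h4 := pow_le_pow_left₀ (abs_nonneg _) hle 4
    rw [(by decide : Even 2).pow_abs] at h2
    rw [(by decide : Even 4).pow_abs] at h4
    simp [h2, h4]
  · set q := p.toReal with hq
    set N := pN a b p h with hNdef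
    have hq4 : 4 ≤ q := by
      have := ENNReal.toReal_mono htop hp
      simpa using this
    have hI0 : 0 ≤ ∫ x in a..b, |h x| ^ q :=
      intervalIntegral.integral_nonneg hab.le fun x _ => Real.rpow_nonneg (abs_nonneg _) _
    have hNq : N ^ q = ∫ x in a..b, |h x| ^ q := by
      rw [hNdef]
      unfold pN
      rw [if_neg htop, ← Real.rpow_mul hI0, one_div, inv_mul_cancel₀ (by linarith : q ≠ 0),
        Real.rpow_one]
    have hci : IntervalIntegrable (fun x => |h x| ^ q) volume a b := by
      apply ContinuousOn.intervalIntegrable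
      rw [uIcc_of_le hab.le]
      exact hc.abs.rpow_const fun x _ => Or.inr (by linarith)
    have hNqpos : 0 < N ^ q := Real.rpow_pos_of_pos hN q
    refine ⟨fun x => 1 + |h x| ^ q / N ^ q, (by simp : IntervalIntegrable (fun _ => (1:ℝ)) volume a b).add (hci.div_const _), ?_, fun x hx => ?_⟩
    · rw [intervalIntegral.integral_add (by simp) (hci.div_const _),
        intervalIntegral.integral_div, ← hNq, div_self hNqpos.ne']
      simp
    · have := aux_pow (|h x| / N) q (by positivity) hq4
      rw [Real.div_rpow (abs_nonneg _) hN.le, div_pow, div_pow, (by decide : Even 2).pow_abs,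
        (by decide : Even 4).pow_abs, div_le_iff₀' (by positivity),
        div_le_iff₀' (by positivity)] at this
      exact this

lemma aux_pt (A B lam t v h : ℝ) (hlam : 0 < lam) (ht : |t| ≤ A) (hv : |v| ≤ B) :
    |t * ((1/2) * (3/2 * v ^ 2 - lam) * h ^ 2 + (1/2) * v * h ^ 3 + h ^ 4 / 8)| ≤
      A * (B ^ 2 + lam + B + 1) * (h ^ 2 + h ^ 4) := by
  have hA := (abs_nonneg t).trans ht
  have hB := (abs_nonneg v).trans hv
  rw [abs_mul, mul_assoc A]
  apply mul_le_mul ht _ (abs_nonneg _) hA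
  have hv2 : v ^ 2 ≤ B ^ 2 := by rw [← sq_abs]; exact pow_le_pow_left₀ (abs_nonneg _) hv 2
  have h3 : |h ^ 3| ≤ h ^ 2 + h ^ 4 := by
    rw [abs_le]; constructor <;> nlinarith [sq_nonneg (h * (h - 1)), sq_nonneg (h * (h + 1)), sq_nonneg h, sq_nonneg (h^2)]
  have h2 : 0 ≤ h ^ 2 := by positivity
  have h4 : 0 ≤ h ^ 4 := by positivity
  have e1 : |(1/2) * (3/2 * v ^ 2 - lam) * h ^ 2| ≤ (B ^ 2 + lam) * h ^ 2 := by
    rw [abs_mul, abs_of_nonneg h2]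
    apply mul_le_mul_of_nonneg_right _ h2
    rw [abs_le]; constructor <;> nlinarith [sq_nonneg v]
  have e2 : |(1/2) * v * h ^ 3| ≤ B * (h ^ 2 + h ^ 4) := by
    rw [abs_mul]
    apply mul_le_mul _ h3 (abs_nonneg _) hB
    rw [abs_mul, abs_of_pos (by norm_num : (0:ℝ) < 1/2)]; linarith [abs_nonneg v]
  have e3 : |h ^ 4 / 8| ≤ h ^ 4 := by rw [abs_of_nonneg (by positivity)]; linarith
  have := abs_add_three ((1/2) * (3/2 * v ^ 2 - lam) * h ^ 2) ((1/2) * v * h ^ 3) (h ^ 4 / 8)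
  have : 0 ≤ (B ^ 2 + lam) * h ^ 4 := by positivity
  nlinarith

theorem stmt3 (a b lam : ℝ) (hab : a < b) (hlam : 0 < lam)
    (θ : ℝ → ℝ) (hθc : ContinuousOn θ (Set.Icc a b)) (hθ : ∀ x ∈ Set.Icc a b, 0 < θ x)
    (F : ℝ → ℝ) (hF : ContDiffOn ℝ 1 F (Set.Icc a b)) (hFa : F a = 0) (hFb : F b = 0)
    (hFne : ∀ x ∈ Set.Ioo a b, F x ≠ 0)
    (hFsmall : supN a b F < (2 * lam / 3) ^ ((3 : ℝ) / 2))
    (p : ENNReal) (hp : 4 ≤ p) :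
    ∀ v : ℝ → ℝ, C0 a b v → ∀ ε > 0, ∃ δ > 0, ∀ h : ℝ → ℝ, C0 a b h →
      0 < pN a b p h → pN a b p h < δ →
      |Kf a b lam θ F (v + h) - Kf a b lam θ F v - Tf a b lam θ F v h| ≤ ε * pN a b p h := by
  intro v hv ε hε
  obtain ⟨A, hA⟩ := isCompact_Icc.exists_bound_of_continuousOn hθc
  obtain ⟨B, hB⟩ := isCompact_Icc.exists_bound_of_continuousOn hv.1
  simp only [Real.norm_eq_abs] at hA hB
  have ha : a ∈ Set.Icc a b := ⟨le_rfl, hab.le⟩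
  have hA0 : 0 < A := (abs_pos.2 (hθ a ha).ne').trans_le (hA a ha)
  have hB0 : 0 ≤ B := (abs_nonneg _).trans (hB a ha)
  set M := A * (B ^ 2 + lam + B + 1) with hM
  have hMpos : 0 < M := by positivity
  have hL : 0 < b - a + 1 := by linarith
  refine ⟨min 1 (ε / (2 * M * (b - a + 1))), by positivity, ?_⟩
  intro h hh hN hNd
  obtain ⟨g, hgi, hg1, hg⟩ := aux_dom a b hab p hp h hh.1 hN
  set N := pN a b p h
  have hvc := hv.1
  have hhc := hh.1
  have hFc := hF.continuousOn
  have i1 : IntervalIntegrable (fun x => θ x * ((1/2) * ((1/2) * (v + h) x ^ 2 - lam) ^ 2 - F x * (v + h) x)) volume a b := by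
    apply ContinuousOn.intervalIntegrable
    rw [uIcc_of_le hab.le]
    simp only [Pi.add_apply]
    fun_prop
  have i2 : IntervalIntegrable (fun x => θ x * ((1/2) * ((1/2) * v x ^ 2 - lam) ^ 2 - F x * v x)) volume a b := by
    apply ContinuousOn.intervalIntegrable
    rw [uIcc_of_le hab.le]
    fun_prop
  have i3 : IntervalIntegrable (fun x => θ x * (v x * ((1/2) * v x ^ 2 - lam) - F x) * h x) volume a b := by
    apply ContinuousOn.intervalIntegrable
    rw [uIcc_of_le hab.le]
    fun_prop
  unfold Kf Tf
  rw [← intervalIntegral.integral_sub i1 i2, ← intervalIntegral.integral_sub (i1.sub i2) i3]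
  have key : ‖∫ x in a..b, (θ x * ((1/2) * ((1/2) * (v + h) x ^ 2 - lam) ^ 2 - F x * (v + h) x)
      - θ x * ((1/2) * ((1/2) * v x ^ 2 - lam) ^ 2 - F x * v x)
      - θ x * (v x * ((1/2) * v x ^ 2 - lam) - F x) * h x)‖ ≤
      ∫ x in a..b, (M * (N ^ 2 + N ^ 4)) * g x := by
    apply intervalIntegral.norm_integral_le_of_norm_le hab.le _ (hgi.const_mul _)
    refine Filter.Eventually.of_forall fun x hx => ?_
    have hx' : x ∈ Set.Icc a b := ⟨hx.1.le, hx.2⟩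
    have h1 := aux_pt A B lam (θ x) (v x) (h x) hlam (hA x hx') (hB x hx')
    have h2 := hg x hx'
    rw [Real.norm_eq_abs]
    calc _ = |θ x * ((1/2) * (3/2 * v x ^ 2 - lam) * h x ^ 2 + (1/2) * v x * h x ^ 3 + h x ^ 4 / 8)| := by
          simp only [Pi.add_apply]; congr 1; ring
      _ ≤ M * (h x ^ 2 + h x ^ 4) := h1
      _ ≤ M * (N ^ 2 * g x + N ^ 4 * g x) := by gcongr; exacts [h2.1, h2.2]
      _ = _ := by ring
  rw [Real.norm_eq_abs, intervalIntegral.integral_const_mul] at key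
  refine key.trans ?_
  have hN1 : N ≤ 1 := hNd.le.trans (min_le_left _ _)
  have hN2 : N ≤ ε / (2 * M * (b - a + 1)) := hNd.le.trans (min_le_right _ _)
  rw [le_div_iff₀ (by positivity)] at hN2
  have hN4 : N ^ 4 ≤ N ^ 2 := pow_le_pow_of_le_one hN.le hN1 (by norm_num)
  calc M * (N ^ 2 + N ^ 4) * ∫ x in a..b, g x
      ≤ M * (N ^ 2 + N ^ 4) * (b - a + 1) := by gcongr
    _ ≤ M * (N ^ 2 + N ^ 2) * (b - a + 1) := by gcongr
    _ = (N * (2 * M * (b - a + 1))) * N := by ring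
    _ ≤ ε * N := by gcongr
end
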